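/- There is no finite group of order 3402 (= 54·63 = 2·3⁵·7) that has an irreducible complex character of degree 54. -/

import Mathlib

open CategoryTheory

/-- `χ : G → ℂ` is the character of an irreducible (simple) finite-dimensional complex
representation of the group `G`. -/
def IsIrrChar (G : Type) [Group G] (χ : G → ℂ) : Prop :=
  ∃ V : FDRep ℂ G, Simple V ∧ FDRep.character V = χ

theorem FDRep.eq_bot_or_eq_top_of_simple {k G : Type} [Field k] [Group G] (V : FDRep k G)
    [Simple V] (W : Submodule k V) (hW : ∀ g : G, ∀ v ∈ W, V.ρ g v ∈ W) : W = ⊥ ∨ W = ⊤ := by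
  let σ : Representation k G W := Subrepresentation.toRepresentation (ρ := V.ρ) ⟨W, hW⟩
  let f : FDRep.of σ ⟶ V := ⟨FGModuleCat.ofHom W.subtype, fun g => by ext; rfl⟩
  have : Mono f := by
    apply (Action.forget (FGModuleCat k) G ⋙ forget (FGModuleCat k)).mono_of_mono_map
    rw [mono_iff_injective]
    exact Subtype.val_injective
  by_cases hf : f = 0
  · left
    rw [eq_bot_iff]
    intro v hv
    have : (f.hom.hom.hom : W →ₗ[k] V) ⟨v, hv⟩ = 0 := by rw [hf]; rfl
    exact this
  · right
    have := isIso_of_mono_of_nonzero hf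
    have h2 : IsIso ((Action.forget (FGModuleCat k) G ⋙ forget (FGModuleCat k)).map f) :=
      inferInstance
    rw [isIso_iff_bijective] at h2
    rw [eq_top_iff]
    intro v _
    obtain ⟨w, hw⟩ := h2.2 v
    have h3 : (w : W).1 = v := hw
    rw [← h3]
    exact (w : W).2

theorem Representation.exists_common_eigenvector {k A V : Type*} [Field k] [IsAlgClosed k]
    [CharZero k] [Group A] [Finite A] [IsMulCommutative A] [AddCommGroup V] [Module k V]
    [FiniteDimensional k V] [Nontrivial V] (ρ : Representation k A V) :
    ∃ v : V, v ≠ 0 ∧ ∀ a : A, ∃ c : k, ρ a v = c • v := by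
  have : NeZero (Nat.card A : k) := ⟨by simp [Nat.card_pos.ne']⟩
  have : Nontrivial (Subrepresentation ρ) := by
    refine ⟨⊥, ⊤, fun h => ?_⟩
    exact bot_ne_top (α := Submodule k V) (congrArg Subrepresentation.toSubmodule h)
  have : IsAtomic (Subrepresentation ρ) :=
    (Subrepresentation.subrepresentationSubmoduleOrderIso (ρ := ρ)).isAtomic_iff.2 inferInstance
  obtain ⟨S, hS⟩ := IsAtomic.exists_atom (α := Subrepresentation ρ)
  have hS0 : S.toSubmodule ≠ ⊥ := fun h => hS.1 (Subrepresentation.toSubmodule_injective h)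
  obtain ⟨v, hv, hv0⟩ := S.toSubmodule.exists_mem_ne_zero_of_ne_bot hS0
  have hirr : S.toRepresentation.IsIrreducible := by
    have : Nontrivial S.toSubmodule := ⟨⟨v, hv⟩, 0, fun h => hv0 (congrArg Subtype.val h)⟩
    have : Nontrivial (Subrepresentation S.toRepresentation) := by
      refine ⟨⊥, ⊤, fun h => ?_⟩
      exact bot_ne_top (α := Submodule k S.toSubmodule)
        (congrArg Subrepresentation.toSubmodule h)
    refine ⟨fun T => ?_⟩
    let T' : Subrepresentation ρ := ⟨T.toSubmodule.map S.toSubmodule.subtype, by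
      rintro g _ ⟨w, hw, rfl⟩
      exact ⟨_, T.apply_mem_toSubmodule g hw, rfl⟩⟩
    have hle : T' ≤ S := by
      rintro _ ⟨w, hw, rfl⟩
      exact w.2
    rcases hS.le_iff.1 hle with h | h
    · left
      apply Subrepresentation.toSubmodule_injective
      have h' : T.toSubmodule.map S.toSubmodule.subtype = ⊥ :=
        congrArg Subrepresentation.toSubmodule h
      apply Submodule.map_injective_of_injective (f := S.toSubmodule.subtype)
        Subtype.val_injective
      rw [h']
      exact (Submodule.map_bot _).symm
    · right
      apply Subrepresentation.toSubmodule_injective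
      have h' : T.toSubmodule.map S.toSubmodule.subtype = S.toSubmodule :=
        congrArg Subrepresentation.toSubmodule h
      apply Submodule.map_injective_of_injective (f := S.toSubmodule.subtype)
        Subtype.val_injective
      rw [h']
      exact (Submodule.map_subtype_top _).symm
  have h1 := Representation.IsIrreducible.finrank_eq_one_of_isMulCommutative S.toRepresentation
  refine ⟨v, hv0, fun a => ?_⟩
  obtain ⟨c, hc⟩ := (finrank_eq_one_iff_of_nonzero' (⟨v, hv⟩ : S.toSubmodule)
    (fun h => hv0 (congrArg Subtype.val h))).1 h1 (S.toRepresentation a ⟨v, hv⟩)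
  exact ⟨c, (congrArg Subtype.val hc).symm⟩

theorem FDRep.finrank_le_index_of_simple {k G : Type} [Field k] [IsAlgClosed k] [CharZero k]
    [Group G] [Finite G] (V : FDRep k G) [Simple V] (A : Subgroup G) [IsMulCommutative A] :
    Module.finrank k V ≤ A.index := by
  rcases subsingleton_or_nontrivial V with h | h
  · rw [Module.finrank_zero_of_subsingleton]
    exact Nat.zero_le _
  obtain ⟨v, hv0, hv⟩ := Representation.exists_common_eigenvector (V.ρ.comp A.subtype)
  let s : G ⧸ A → V := fun q => V.ρ q.out v
  have hs : ∀ g : G, V.ρ g v ∈ Submodule.span k (Set.range s) := by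
    intro g
    obtain ⟨a, ha⟩ := QuotientGroup.mk_out_eq_mul A g
    obtain ⟨c, hc⟩ := hv a⁻¹
    have hg : g = (g : G ⧸ A).out * (a⁻¹ : A) := by rw [ha]; simp
    have h1 : V.ρ g v = c • s g := by
      have hc' : V.ρ ((a⁻¹ : A) : G) v = c • v := hc
      conv_lhs => rw [hg, map_mul, Module.End.mul_apply, hc', map_smul]
    rw [h1]
    exact Submodule.smul_mem _ _ (Submodule.subset_span ⟨_, rfl⟩)
  have htop : Submodule.span k (Set.range s) = ⊤ := by
    refine (V.eq_bot_or_eq_top_of_simple _ ?_).resolve_left ?_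
    · intro g w hw
      induction hw using Submodule.span_induction with
      | mem x hx =>
        obtain ⟨q, rfl⟩ := hx
        have := hs (g * q.out)
        rwa [map_mul, Module.End.mul_apply] at this
      | zero => rw [map_zero]; exact Submodule.zero_mem _
      | add x y _ _ hx hy => rw [map_add]; exact Submodule.add_mem _ hx hy
      | smul c x _ hx => rw [map_smul]; exact Submodule.smul_mem _ _ hx
    · intro h
      have := hs 1
      rw [h, map_one] at this
      exact hv0 this
  have := Fintype.ofFinite (G ⧸ A)
  have h2 := finrank_range_le_card (R := k) s
  rw [Set.finrank, htop, finrank_top, ← Nat.card_eq_fintype_card] at h2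
  exact h2

section

open Subgroup

theorem Subgroup.exists_card_eq_of_card_eq_two_mul {G : Type*} [Group G] {m : ℕ} (hm : Odd m)
    (hG : Nat.card G = 2 * m) : ∃ N : Subgroup G, Nat.card N = m := by
  have : Finite G := Nat.finite_of_card_ne_zero (by rw [hG]; have := hm.pos; omega)
  let P : Sylow 2 G := default
  have hP : Nat.card P = 2 := by
    rw [P.card_eq_multiplicity, hG, Nat.factorization_mul (by norm_num) hm.pos.ne']
    simp [Nat.factorization_eq_zero_of_not_dvd hm.not_two_dvd_nat, Nat.prime_two.factorization_self]
  have hc : IsCyclic P := isCyclic_of_prime_card hP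
  have hmin : (Nat.card G).minFac = 2 := by
    rw [hG]; exact (Nat.minFac_eq_two_iff _).2 (dvd_mul_right _ _)
  have h := (IsCyclic.isComplement' hmin hc).card_mul_card
  refine ⟨(MonoidHom.transferSylow P (hc.normalizer_le_centralizer hmin)).ker, ?_⟩
  rw [hG, hP] at h
  omega

theorem Subgroup.isMulCommutative_closure_insert {G : Type*} [Group G] (B : Subgroup G)
    [IsMulCommutative B] {y : G} (hy : y ∈ centralizer (B : Set G)) :
    IsMulCommutative (closure (insert y (B : Set G))) := by
  apply isMulCommutative_closure
  rintro a (rfl | ha) b (rfl | hb)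
  · rfl
  · exact (hy b hb).symm
  · exact hy a ha
  · exact congrArg Subtype.val (mul_comm' (⟨a, ha⟩ : B) ⟨b, hb⟩)

theorem IsPGroup.mul_card_dvd_card_of_lt {p : ℕ} [Fact p.Prime] {G : Type*} [Group G] [Finite G]
    (hG : IsPGroup p G) {B C : Subgroup G} (h : B < C) : p * Nat.card B ∣ Nat.card C := by
  obtain ⟨m, hm⟩ := (hG.to_subgroup B).exists_card_eq
  obtain ⟨n, hn⟩ := (hG.to_subgroup C).exists_card_eq
  have hlt : Nat.card B < Nat.card C := by
    by_contra hle
    exact h.ne (eq_of_le_of_card_ge h.le (not_lt.1 hle))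
  rw [hm, hn] at *
  rw [← pow_succ']
  exact pow_dvd_pow _ ((Nat.pow_lt_pow_iff_right (Fact.out : p.Prime).one_lt).1 hlt)

theorem IsPGroup.mul_card_dvd_card_closure_insert {p : ℕ} [Fact p.Prime] {G : Type*} [Group G]
    [Finite G] (hG : IsPGroup p G) (B : Subgroup G) {y : G} (hy : y ∉ B) :
    p * Nat.card B ∣ Nat.card (closure (insert y (B : Set G))) := by
  refine hG.mul_card_dvd_card_of_lt (lt_of_le_of_ne ?_ ?_)
  · exact fun b hb => subset_closure (Set.mem_insert_of_mem _ hb)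
  · intro h
    exact hy (h ▸ subset_closure (Set.mem_insert _ _))

theorem Subgroup.index_centralizer_singleton_le {G : Type*} [Group G] (Z : Subgroup G) [Finite Z]
    {x : G} (hx : ∀ g : G, g * x * g⁻¹ * x⁻¹ ∈ Z) : (centralizer {x}).index ≤ Nat.card Z := by
  refine Nat.card_le_card_of_injective
    (fun q : G ⧸ centralizer {x} => (⟨_, hx q.out⟩ : Z)) fun q r h => ?_
  have h1 : q.out * x * q.out⁻¹ = r.out * x * r.out⁻¹ :=
    mul_right_cancel (congrArg Subtype.val h)
  rw [← q.out_eq', ← r.out_eq']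
  refine QuotientGroup.eq.2 (mem_centralizer_singleton_iff.2 ?_)
  calc q.out⁻¹ * r.out * x = q.out⁻¹ * (r.out * x * r.out⁻¹) * r.out := by group
    _ = x * (q.out⁻¹ * r.out) := by rw [← h1]; group

theorem IsPGroup.exists_isMulCommutative_of_card_eq_pow_four {p : ℕ} [Fact p.Prime] {G : Type*}
    [Group G] (hG : Nat.card G = p ^ 4) :
    ∃ B : Subgroup G, IsMulCommutative B ∧ p ^ 3 ∣ Nat.card B := by
  have hp : p.Prime := Fact.out
  have : Finite G := Nat.finite_of_card_ne_zero (by rw [hG]; exact pow_ne_zero _ hp.ne_zero)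
  have hGp : IsPGroup p G := IsPGroup.of_card hG
  have : Nontrivial G := by
    rw [← Finite.one_lt_card_iff_nontrivial, hG]
    exact Nat.one_lt_pow (by norm_num) hp.one_lt
  have hZ : p ∣ Nat.card (center G) := by
    simpa using hGp.mul_card_dvd_card_of_lt hGp.bot_lt_center
  by_cases htop : center G = ⊤
  · refine ⟨center G, inferInstance, ?_⟩
    rw [htop, card_top, hG]
    exact pow_dvd_pow _ (by norm_num)
  have hne : Nontrivial (G ⧸ center G) := QuotientGroup.nontrivial_iff.2 htop
  have hcn := (hGp.to_quotient (center G)).center_nontrivial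
  obtain ⟨⟨x', hx'⟩, hx1⟩ := exists_ne (1 : center (G ⧸ center G))
  obtain ⟨x, rfl⟩ := QuotientGroup.mk_surjective x'
  have hxZ : x ∉ center G := fun h =>
    hx1 (Subtype.ext ((QuotientGroup.eq_one_iff x).2 h))
  have hcomm : ∀ g : G, g * x * g⁻¹ * x⁻¹ ∈ center G := by
    intro g
    rw [← QuotientGroup.eq_one_iff]
    have := mem_center_iff.1 hx' g
    simp only [QuotientGroup.mk_mul, QuotientGroup.mk_inv, this]
    group
  have hxC : x ∈ centralizer (center G : Set G) := fun z hz => (mem_center_iff.1 hz x).symm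
  set B := closure (insert x (center G : Set G)) with hB
  have hBc : IsMulCommutative B := isMulCommutative_closure_insert _ hxC
  have hBd : p * Nat.card (center G) ∣ Nat.card B := hGp.mul_card_dvd_card_closure_insert _ hxZ
  have hBd2 : p ^ 2 ∣ Nat.card B := by
    rw [pow_two]
    exact (mul_dvd_mul_left p hZ).trans hBd
  by_cases hle : centralizer {x} ≤ B
  · refine ⟨B, hBc, ?_⟩
    have hidx := index_centralizer_singleton_le (center G) hcomm
    have hmul := (centralizer {x}).card_mul_index
    have h1 : p ^ 4 ≤ Nat.card B * Nat.card (center G) := by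
      rw [← hG, ← hmul]
      exact Nat.mul_le_mul (Nat.card_le_card_of_injective _ (inclusion_injective hle)) hidx
    have h2 := Nat.le_of_dvd Nat.card_pos hBd
    obtain ⟨m, hm⟩ := (hGp.to_subgroup B).exists_card_eq
    rw [hm]
    refine pow_dvd_pow _ ?_
    by_contra hlt
    have h3 : p ^ m ≤ p ^ 2 := Nat.pow_le_pow_right hp.pos (by omega)
    rw [hm] at h1 h2
    have h4 : p * p ^ 4 ≤ p ^ 2 * p ^ 2 := by
      calc p * p ^ 4 ≤ p * (p ^ m * Nat.card (center G)) := Nat.mul_le_mul_left _ h1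
        _ = p ^ m * (p * Nat.card (center G)) := by ring
        _ ≤ p ^ 2 * p ^ 2 := Nat.mul_le_mul h3 (h2.trans h3)
    rw [← pow_succ', ← pow_add] at h4
    have := (Nat.pow_le_pow_iff_right hp.one_lt).1 h4
    omega
  · obtain ⟨y, hy, hyB⟩ := SetLike.not_le_iff_exists.1 hle
    have hyC : y ∈ centralizer (B : Set G) := by
      rw [hB, centralizer_closure, mem_centralizer_iff]
      rintro z (rfl | hz)
      · exact (mem_centralizer_singleton_iff.1 hy).symm
      · exact (mem_center_iff.1 hz y).symm
    refine ⟨_, isMulCommutative_closure_insert B hyC, ?_⟩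
    rw [pow_succ']
    exact (mul_dvd_mul_left p hBd2).trans (hGp.mul_card_dvd_card_closure_insert B hyB)

theorem Subgroup.relIndex_centralizer_normalizer_dvd {G : Type*} [Group G] [Finite G]
    (P : Subgroup G) (hP : (Nat.card P).Prime) :
    (centralizer (P : Set G)).relIndex (normalizer (P : Set G)) ∣ Nat.card P - 1 := by
  have := Fact.mk hP
  have hc : IsCyclic P := isCyclic_of_prime_card rfl
  have key := card_dvd_of_injective _ (QuotientGroup.kerLift_injective P.normalizerMonoidHom)
  rwa [normalizerMonoidHom_ker, ← index, ← relIndex, hc.card_mulAut, Nat.totient_prime hP] at key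

theorem exists_isMulCommutative_of_card_eq_1701 {N : Type*} [Group N] (hN : Nat.card N = 1701) :
    ∃ A : Subgroup N, IsMulCommutative A ∧ 189 ∣ Nat.card A := by
  have : Finite N := Nat.finite_of_card_ne_zero (by rw [hN]; norm_num)
  have : Fact (Nat.Prime 7) := ⟨by norm_num⟩
  have : Fact (Nat.Prime 3) := ⟨by norm_num⟩
  obtain ⟨P⟩ : Nonempty (Sylow 7 N) := inferInstance
  have hP : Nat.card P = 7 := by
    have h := P.card_eq_multiplicity
    rwa [hN, show (1701 : ℕ) = 7 * 3 ^ 5 by norm_num,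
      Nat.factorization_mul (by norm_num) (by norm_num), Finsupp.add_apply,
      Nat.Prime.factorization_self (by norm_num),
      Nat.factorization_eq_zero_of_not_dvd (by norm_num)] at h
  have hidx : P.index = 243 := by
    have := P.card_mul_index
    rw [hN] at this
    have h2 : Nat.card (P : Subgroup N) = 7 := hP
    rw [h2] at this
    omega
  have hs : Nat.card (Sylow 7 N) = 1 := by
    have h1 := P.card_dvd_index
    rw [hidx, show (243 : ℕ) = 3 ^ 5 by norm_num, Nat.dvd_prime_pow (by norm_num)] at h1
    have h2 := card_sylow_modEq_one 7 N
    obtain ⟨k, hk, h1⟩ := h1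
    rw [h1] at h2 ⊢
    interval_cases k <;> revert h2 <;> decide
  have hsub : Subsingleton (Sylow 7 N) := (Nat.card_eq_one_iff_unique.1 hs).1
  have hn : (P : Subgroup N).Normal := P.normal_of_subsingleton
  set C := centralizer ((P : Subgroup N) : Set N) with hC
  have hCi : C.index ∣ 6 := by
    have := relIndex_centralizer_normalizer_dvd (P : Subgroup N) (by rw [hP]; norm_num)
    rwa [normalizer_eq_top, relIndex_top_right, hP] at this
  have hCc : 3 ^ 4 ∣ Nat.card C := by
    have h := C.card_mul_index
    obtain ⟨d, hd⟩ := hCi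
    rw [hN] at h
    have : Nat.card C * 2 = 567 * d := by nlinarith
    omega
  obtain ⟨Q, hQ⟩ := Sylow.exists_subgroup_card_pow_prime 3 hCc
  obtain ⟨B, hB, hBc⟩ := IsPGroup.exists_isMulCommutative_of_card_eq_pow_four hQ
  set B' : Subgroup N := (B.map Q.subtype).map C.subtype with hB'
  have hB'c : IsMulCommutative B' := inferInstance
  have hcard : Nat.card B' = Nat.card B := by
    rw [hB', card_map_of_injective C.subtype_injective, card_map_of_injective Q.subtype_injective]
  have hPc : IsMulCommutative (P : Subgroup N) :=
    have : IsCyclic (P : Subgroup N) := isCyclic_of_prime_card hP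
    inferInstance
  have hBP : ∀ b ∈ B', ∀ x ∈ (P : Subgroup N), b * x = x * b := by
    rintro _ ⟨c, -, rfl⟩ x hx
    exact (c.2 x hx).symm
  refine ⟨closure (B' ∪ (P : Subgroup N) : Set N), ?_, ?_⟩
  · apply isMulCommutative_closure
    rintro a (ha | ha) b (hb | hb)
    · exact congrArg Subtype.val (mul_comm' (⟨a, ha⟩ : B') ⟨b, hb⟩)
    · exact hBP a ha b hb
    · exact (hBP b hb a ha).symm
    · exact congrArg Subtype.val (mul_comm' (⟨a, ha⟩ : (P : Subgroup N)) ⟨b, hb⟩)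
  · have h1 : Nat.card B' ∣ Nat.card (closure (B' ∪ (P : Subgroup N) : Set N)) :=
      card_dvd_of_le fun b hb => subset_closure (Or.inl hb)
    have h2 : Nat.card P ∣ Nat.card (closure (B' ∪ (P : Subgroup N) : Set N)) :=
      card_dvd_of_le fun b hb => subset_closure (Or.inr hb)
    rw [hcard] at h1
    rw [hP] at h2
    have h3 := hBc.trans h1
    omega

end

/-- There is no finite group of order 3402 with an irreducible complex character
of degree 54. -/
theorem no_group_order_3402_degree_54 (G : Type) [Group G] [Finite G]
    (hcard : Nat.card G = 3402)
    (χ : G → ℂ) (hχ : IsIrrChar G χ) (hdeg : χ 1 = (54 : ℂ)) :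
    False := by
  obtain ⟨V, hV, rfl⟩ := hχ
  rw [FDRep.char_one] at hdeg
  have hdim : Module.finrank ℂ V = 54 := by exact_mod_cast hdeg
  obtain ⟨N, hN⟩ := Subgroup.exists_card_eq_of_card_eq_two_mul (m := 1701) (by decide) hcard
  obtain ⟨A, hA, hAc⟩ := exists_isMulCommutative_of_card_eq_1701 hN
  have hle := V.finrank_le_index_of_simple (A.map N.subtype)
  have hmul := (A.map N.subtype).card_mul_index
  rw [Subgroup.card_map_of_injective N.subtype_injective, hcard] at hmul
  have h189 := Nat.le_of_dvd Nat.card_pos hAc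
  rw [hdim] at hle
  nlinarith
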